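/- arXiv:1210.0196 — 2 statements merged into one kernel-verified Lean document; each statement's English description precedes it below -/
import Mathlib

section
/- Let A be an abelian category with enough injectives, let (W, F) be an injective cotorsion pair, and let T be a class of objects of F which contains all injective objects and is F-thick (closed under direct summands, and whenever two of the three terms of a short exact sequence whose terms all lie in F belong to T, so does the third). Define W_T = {A ∈ A | there exists a short exact sequence 0 → A → T → W → 0 with T ∈ T and W ∈ W}. Then: (1) an object A lies in W_T if and only if for every short exact sequence 0 → A → F → W → 0 with F ∈ F and W ∈ W one has F ∈ T; (2) W_T is a thick class of objects of A containing both T and W; (3) W_T ∩ F = T. -/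
open CategoryTheory CategoryTheory.Limits

universe w v u

variable {A : Type u} [Category.{v} A] [Abelian A]

/-- `IsShortExact i p` asserts that `0 → X → Y → Z → 0` is a short exact sequence. -/
def IsShortExact {X Y Z : A} (i : X ⟶ Y) (p : Y ⟶ Z) : Prop :=
  ∃ w : i ≫ p = 0, (ShortComplex.mk i p w).ShortExact

section Ext

variable [HasExt.{w} A]

/-- `Ext¹(X, Y) = 0`. -/
def Ext1Zero (X Y : A) : Prop := Subsingleton (Abelian.Ext X Y 1)

/-- `(F, C)` is a cotorsion pair: each class is the `Ext¹`-orthogonal of the other. -/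
def IsCotorsionPair (F C : Set A) : Prop :=
  (∀ X : A, X ∈ F ↔ ∀ Y ∈ C, Ext1Zero.{w} X Y) ∧
  (∀ Y : A, Y ∈ C ↔ ∀ X ∈ F, Ext1Zero.{w} X Y)

/-- A complete cotorsion pair: for every object `X` there are short exact sequences
`0 → C → F → X → 0` and `0 → X → C' → F' → 0` with `F, F'` in the left class and
`C, C'` in the right class. -/
def IsCompleteCotorsionPair (F C : Set A) : Prop :=
  IsCotorsionPair.{w} F C ∧
  (∀ X : A, ∃ (Co Fo : A) (i : Co ⟶ Fo) (p : Fo ⟶ X),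
    Co ∈ C ∧ Fo ∈ F ∧ IsShortExact i p) ∧
  (∀ X : A, ∃ (Co Fo : A) (i : X ⟶ Co) (p : Co ⟶ Fo),
    Co ∈ C ∧ Fo ∈ F ∧ IsShortExact i p)

end Ext

/-- A thick class: closed under direct summands (retracts) and satisfying two-out-of-three
for short exact sequences. -/
def IsThickClass (W : Set A) : Prop :=
  (∀ (X Y : A) (s : Y ⟶ X) (r : X ⟶ Y), s ≫ r = 𝟙 Y → X ∈ W → Y ∈ W) ∧
  (∀ ⦃X Y Z : A⦄ (i : X ⟶ Y) (p : Y ⟶ Z), IsShortExact i p →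
    (X ∈ W → Y ∈ W → Z ∈ W) ∧ (X ∈ W → Z ∈ W → Y ∈ W) ∧ (Y ∈ W → Z ∈ W → X ∈ W))

/-- The class `F` is closed under kernels of epimorphisms between objects of `F`. -/
def ClosedUnderKernelsOfEpis (F : Set A) : Prop :=
  ∀ ⦃X Y Z : A⦄ (i : X ⟶ Y) (p : Y ⟶ Z), IsShortExact i p → Y ∈ F → Z ∈ F → X ∈ F

/-- The class `C` is closed under cokernels of monomorphisms between objects of `C`. -/
def ClosedUnderCokernelsOfMonos (C : Set A) : Prop :=
  ∀ ⦃X Y Z : A⦄ (i : X ⟶ Y) (p : Y ⟶ Z), IsShortExact i p → X ∈ C → Y ∈ C → Z ∈ C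

/-- An injective cotorsion pair: a complete cotorsion pair `(W, F)` with `W` thick and
`W ∩ F` equal to the class of injective objects. -/
def IsInjectiveCotorsionPair [HasExt.{w} A] (W F : Set A) : Prop :=
  IsCompleteCotorsionPair.{w} W F ∧ IsThickClass W ∧
  ∀ X : A, (X ∈ W ∧ X ∈ F) ↔ Injective X

/-- A projective cotorsion pair: a complete cotorsion pair `(C, W)` with `W` thick and
`C ∩ W` equal to the class of projective objects. -/
def IsProjectiveCotorsionPair [HasExt.{w} A] (C W : Set A) : Prop :=
  IsCompleteCotorsionPair.{w} C W ∧ IsThickClass W ∧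
  ∀ X : A, (X ∈ C ∧ X ∈ W) ↔ Projective X

/-- A Hovey triple `(Q, W, R)`: `W` is thick and both `(Q, W ∩ R)` and `(Q ∩ W, R)` are
complete cotorsion pairs. -/
def IsHoveyTriple [HasExt.{w} A] (Q W R : Set A) : Prop :=
  IsThickClass W ∧ IsCompleteCotorsionPair.{w} Q (W ∩ R) ∧
    IsCompleteCotorsionPair.{w} (Q ∩ W) R

/-- `T` is an `F`-thick class: a subclass of `F` closed under direct summands and satisfying
two-out-of-three on short exact sequences all of whose terms lie in `F`. -/
def IsFThick (F T : Set A) : Prop :=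
  (∀ (X Y : A) (s : Y ⟶ X) (r : X ⟶ Y), s ≫ r = 𝟙 Y → X ∈ T → Y ∈ T) ∧
  (∀ ⦃X Y Z : A⦄ (i : X ⟶ Y) (p : Y ⟶ Z), IsShortExact i p →
    X ∈ F → Y ∈ F → Z ∈ F →
    ((X ∈ T → Y ∈ T → Z ∈ T) ∧ (X ∈ T → Z ∈ T → Y ∈ T) ∧ (Y ∈ T → Z ∈ T → X ∈ T)))

/-- `WClass W T` is the class of all objects `X` admitting a short exact sequence
`0 → X → T₀ → W₀ → 0` with `T₀ ∈ T` and `W₀ ∈ W`. -/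
def WClass (W T : Set A) : Set A :=
  {X : A | ∃ (To Wo : A) (i : X ⟶ To) (p : To ⟶ Wo), IsShortExact i p ∧ To ∈ T ∧ Wo ∈ W}

theorem ses_mk_cok {X Y Z : A} (i : X ⟶ Y) (p : Y ⟶ Z) (hi : Mono i) (hp : Epi p)
    (w : i ≫ p = 0) (hd : ∀ {B : A} (k : Y ⟶ B), i ≫ k = 0 → ∃ l : Z ⟶ B, p ≫ l = k) :
    IsShortExact i p :=
  ⟨w, { exact := ShortComplex.exact_of_g_is_cokernel _
          (CokernelCofork.IsColimit.ofπ' p w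
            (fun k hk => ⟨(hd k hk).choose, (hd k hk).choose_spec⟩))
        mono_f := hi
        epi_g := hp }⟩

theorem ses_mk_ker {X Y Z : A} (i : X ⟶ Y) (p : Y ⟶ Z) (hi : Mono i) (hp : Epi p)
    (w : i ≫ p = 0) (hd : ∀ {B : A} (k : B ⟶ Y), k ≫ p = 0 → ∃ l : B ⟶ X, l ≫ i = k) :
    IsShortExact i p :=
  ⟨w, { exact := ShortComplex.exact_of_f_is_kernel _
          (KernelFork.IsLimit.ofι' i w
            (fun k hk => ⟨(hd k hk).choose, (hd k hk).choose_spec⟩))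
        mono_f := hi
        epi_g := hp }⟩

theorem ses_zero {X Y Z : A} {i : X ⟶ Y} {p : Y ⟶ Z} (h : IsShortExact i p) : i ≫ p = 0 := h.1

theorem ses_mono {X Y Z : A} {i : X ⟶ Y} {p : Y ⟶ Z} (h : IsShortExact i p) : Mono i :=
  h.2.mono_f

theorem ses_epi {X Y Z : A} {i : X ⟶ Y} {p : Y ⟶ Z} (h : IsShortExact i p) : Epi p :=
  h.2.epi_g

theorem ses_lift {X Y Z : A} {i : X ⟶ Y} {p : Y ⟶ Z} (h : IsShortExact i p)
    {B : A} (k : B ⟶ Y) (hk : k ≫ p = 0) : ∃ l : B ⟶ X, l ≫ i = k := by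
  have := ses_mono h
  exact ⟨_, KernelFork.IsLimit.lift' h.2.fIsKernel k hk |>.2⟩

theorem ses_desc {X Y Z : A} {i : X ⟶ Y} {p : Y ⟶ Z} (h : IsShortExact i p)
    {B : A} (k : Y ⟶ B) (hk : i ≫ k = 0) : ∃ l : Z ⟶ B, p ≫ l = k := by
  have := ses_epi h
  exact ⟨_, CokernelCofork.IsColimit.desc' h.2.gIsCokernel k hk |>.2⟩

/-- Pushout of a short exact sequence along a map of the left term. -/
theorem ses_pushout {X Y Z X' : A} {i : X ⟶ Y} {p : Y ⟶ Z} (h : IsShortExact i p)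
    (f : X ⟶ X') : ∃ q : pushout f i ⟶ Z, IsShortExact (pushout.inl f i) q := by
  have := ses_mono h
  have := ses_epi h
  have e : pushout.inr f i ≫ pushout.desc (0 : X' ⟶ Z) p (by simp [ses_zero h]) = p := by simp [pushout.inl_desc, pushout.inr_desc, pushout.inl_desc_assoc, pushout.inr_desc_assoc]
  refine ⟨pushout.desc 0 p (by simp [ses_zero h]), ses_mk_cok _ _ inferInstance ?_ (by simp [pushout.inl_desc, pushout.inr_desc, pushout.inl_desc_assoc, pushout.inr_desc_assoc]) ?_⟩
  · exact epi_of_epi_fac e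
  · intro B k hk
    obtain ⟨l, hl⟩ := ses_desc h (pushout.inr f i ≫ k) (by
      rw [← pushout.condition_assoc, hk, comp_zero])
    refine ⟨l, ?_⟩
    apply pushout.hom_ext
    · simp [pushout.inl_desc, pushout.inr_desc, pushout.inl_desc_assoc, pushout.inr_desc_assoc, hk]
    · simp [pushout.inl_desc, pushout.inr_desc, pushout.inl_desc_assoc, pushout.inr_desc_assoc, hl]

/-- Cokernel of a composite of monos, as a pushout. -/
theorem ses_comp {X Y Z V U : A} {i : X ⟶ Y} {p : Y ⟶ Z} (h : IsShortExact i p)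
    {j : Y ⟶ V} {q : V ⟶ U} (h' : IsShortExact j q) :
    ∃ (C : A) (r : V ⟶ C) (a : Z ⟶ C) (b : C ⟶ U),
      IsShortExact (i ≫ j) r ∧ IsShortExact a b := by
  have := ses_mono h
  have := ses_epi h
  have := ses_mono h'
  obtain ⟨b, hb⟩ := ses_pushout h' p
  refine ⟨pushout p j, pushout.inr p j, pushout.inl p j, b, ?_, hb⟩
  refine ses_mk_cok _ _ inferInstance inferInstance ?_ ?_
  · rw [Category.assoc, ← pushout.condition, ← Category.assoc, ses_zero h, zero_comp]
  · intro B k hk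
    obtain ⟨l, hl⟩ := ses_desc h (j ≫ k) (by simpa using hk)
    exact ⟨pushout.desc l k hl, by simp [pushout.inl_desc, pushout.inr_desc, pushout.inl_desc_assoc, pushout.inr_desc_assoc]⟩

/-- Pullback of a short exact sequence. -/
theorem ses_pullback {X Y Z Z' : A} {i : X ⟶ Y} {p : Y ⟶ Z} (h : IsShortExact i p)
    (f : Z' ⟶ Z) : ∃ q : X ⟶ pullback p f, q ≫ pullback.fst p f = i ∧
      IsShortExact q (pullback.snd p f) := by
  have := ses_mono h
  have := ses_epi h
  have e : pullback.lift i (0 : X ⟶ Z') (by simp [ses_zero h]) ≫ pullback.fst p f = i := by simp [pullback.lift_fst, pullback.lift_snd, pullback.lift_fst_assoc, pullback.lift_snd_assoc]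
  refine ⟨pullback.lift i 0 (by simp [ses_zero h]), e,
    ses_mk_ker _ _ ?_ inferInstance (by simp [pullback.lift_fst, pullback.lift_snd, pullback.lift_fst_assoc, pullback.lift_snd_assoc]) ?_⟩
  · exact mono_of_mono_fac e
  · intro B k hk
    obtain ⟨l, hl⟩ := ses_lift h (k ≫ pullback.fst p f) (by
      rw [Category.assoc, pullback.condition, reassoc_of% hk, zero_comp])
    refine ⟨l, ?_⟩
    apply pullback.hom_ext
    · simp [pullback.lift_fst, pullback.lift_snd, pullback.lift_fst_assoc, pullback.lift_snd_assoc, hl]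
    · simp [pullback.lift_fst, pullback.lift_snd, pullback.lift_fst_assoc, pullback.lift_snd_assoc, hk]

theorem ses_pullback_comp {K V E C U : A} {i : K ⟶ V} {p : V ⟶ E} (h : IsShortExact i p)
    {j : C ⟶ E} {q : E ⟶ U} (h' : IsShortExact j q) :
    IsShortExact (pullback.fst p j) (p ≫ q) := by
  have := ses_epi h
  have := ses_mono h'
  have := ses_epi h'
  refine ses_mk_ker _ _ inferInstance inferInstance ?_ ?_
  · rw [pullback.condition_assoc, ses_zero h', comp_zero]
  · intro B k hk
    obtain ⟨l, hl⟩ := ses_lift h' (k ≫ p) (by simpa using hk)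
    exact ⟨pullback.lift k l hl.symm, by simp [pullback.lift_fst, pullback.lift_snd, pullback.lift_fst_assoc, pullback.lift_snd_assoc]⟩

theorem ses_id {X Z : A} (hZ : IsZero Z) : IsShortExact (𝟙 X) (0 : X ⟶ Z) := by
  refine ses_mk_ker _ _ inferInstance ⟨fun _ _ _ => hZ.eq_of_src _ _⟩ (by simp) ?_
  intro B k _
  exact ⟨k, by simp⟩

theorem ses_biprod (X Y : A) : IsShortExact (biprod.inl : X ⟶ X ⊞ Y) biprod.snd := by
  refine ses_mk_ker _ _ inferInstance inferInstance (by simp) ?_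
  intro B k hk
  refine ⟨k ≫ biprod.fst, ?_⟩
  apply biprod.hom_ext
  · simp
  · simp [hk]

section Pair

variable [HasExt.{w} A] {W F : Set A}

theorem cp_extend (h : IsCotorsionPair.{w} W F) {X Y Z G : A} {i : X ⟶ Y} {p : Y ⟶ Z}
    (hs : IsShortExact i p) (hZ : Z ∈ W) (hG : G ∈ F) (f : X ⟶ G) : ∃ g : Y ⟶ G, i ≫ g = f := by
  have hsub : Subsingleton (Abelian.Ext Z G 1) := (h.1 Z).1 hZ G hG
  obtain ⟨x, hx⟩ := Abelian.Ext.contravariant_sequence_exact₁ hs.2 G (Abelian.Ext.mk₀ f)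
    (add_zero 1) (Subsingleton.elim _ _)
  obtain ⟨g, rfl⟩ := (Abelian.Ext.mk₀_bijective _ _).2 x
  refine ⟨g, (Abelian.Ext.mk₀_bijective _ _).1 ?_⟩
  simpa using hx

theorem cp_section (h : IsCotorsionPair.{w} W F) {X Y Z : A} {i : X ⟶ Y} {p : Y ⟶ Z}
    (hs : IsShortExact i p) (hZ : Z ∈ W) (hX : X ∈ F) : ∃ s : Z ⟶ Y, s ≫ p = 𝟙 Z := by
  obtain ⟨g, hg⟩ := cp_extend h hs hZ hX (𝟙 X)
  obtain ⟨s, hs'⟩ := ses_desc hs (𝟙 Y - g ≫ i) (by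
    rw [Preadditive.comp_sub, reassoc_of% hg]; simp)
  have := ses_epi hs
  refine ⟨s, ?_⟩
  rw [← cancel_epi p, reassoc_of% hs', Preadditive.sub_comp, Category.assoc, ses_zero hs]
  simp

theorem cp_ext (h : IsCotorsionPair.{w} W F) {X Y Z : A} {i : X ⟶ Y} {p : Y ⟶ Z}
    (hs : IsShortExact i p) (hX : X ∈ F) (hZ : Z ∈ F) : Y ∈ F := by
  rw [h.2]
  intro V hV
  have h1 : Subsingleton (Abelian.Ext V X 1) := (h.1 V).1 hV X hX
  have h3 : Subsingleton (Abelian.Ext V Z 1) := (h.1 V).1 hV Z hZ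
  have key : ∀ x : Abelian.Ext V Y 1, x = 0 := by
    intro x
    obtain ⟨y, rfl⟩ := Abelian.Ext.covariant_sequence_exact₂ V hs.2 x (Subsingleton.elim _ _)
    have : y = 0 := Subsingleton.elim _ _
    rw [this, Abelian.Ext.zero_comp]
  exact ⟨fun a b => by rw [key a, key b]⟩

theorem cp_retract (h : IsCotorsionPair.{w} W F) {X Y : A} (s : Y ⟶ X) (r : X ⟶ Y)
    (e : s ≫ r = 𝟙 Y) (hX : X ∈ F) : Y ∈ F := by
  rw [h.2]
  intro V hV
  have h1 : Subsingleton (Abelian.Ext V X 1) := (h.1 V).1 hV X hX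
  have key : ∀ x : Abelian.Ext V Y 1, x = 0 := by
    intro x
    have e1 : x.comp (Abelian.Ext.mk₀ s) (add_zero 1) = 0 := Subsingleton.elim _ _
    have e2 : (x.comp (Abelian.Ext.mk₀ s) (add_zero 1)).comp (Abelian.Ext.mk₀ r) (add_zero 1)
        = x := by
      rw [Abelian.Ext.comp_assoc_of_third_deg_zero, Abelian.Ext.mk₀_comp_mk₀, e,
        Abelian.Ext.comp_mk₀_id]
    rw [← e2, e1, Abelian.Ext.zero_comp]
  exact ⟨fun a b => by rw [key a, key b]⟩

/-- The right class is closed under cokernels of monomorphisms. -/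
theorem icp_coker (h : IsInjectiveCotorsionPair.{w} W F) : ClosedUnderCokernelsOfMonos F := by
  obtain ⟨⟨hc, hl, hr⟩, hW, hI⟩ := h
  intro F1 F2 C i p hs h1 h2
  obtain ⟨F3, W3, j, q, h3, hW3, hjq⟩ := hr C
  obtain ⟨K, V, k, t, hK, hV, hkt⟩ := hl F3
  obtain ⟨k', hk', hs'⟩ := ses_pullback hkt j
  have hs'' := ses_pullback_comp hkt hjq
  have hPW : pullback t j ∈ W := (hW.2 _ _ hs'').2.2 hV hW3
  -- the pullback of `F2` and `pullback t j` over `C`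
  have hPF : pullback t j ∈ F := by
    obtain ⟨a, -, ha⟩ := ses_pullback hs (pullback.snd t j)
    obtain ⟨σ, hσ⟩ := cp_section hc ha hPW h1
    refine cp_retract hc σ _ hσ ?_
    obtain ⟨b, -, hb⟩ := ses_pullback hs' p
    have hQ := cp_ext hc hb hK h2
    exact cp_retract hc (pullbackSymmetry _ _).hom (pullbackSymmetry _ _).inv (by simp) hQ
  have hinj : Injective (pullback t j) := (hI _).1 ⟨hPW, hPF⟩
  have := ses_mono hs''
  have := ses_epi hs'
  obtain ⟨ρ, hρ⟩ : ∃ ρ, pullback.fst t j ≫ ρ = 𝟙 _ :=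
    ⟨Injective.factorThru (𝟙 _) (pullback.fst t j), Injective.comp_factorThru _ _⟩
  obtain ⟨ret, hret⟩ := ses_desc hkt (ρ ≫ pullback.snd t j) (by
    rw [← hk', Category.assoc, reassoc_of% hρ, ses_zero hs'])
  refine cp_retract hc j ret ?_ h3
  rw [← cancel_epi (pullback.snd t j), ← pullback.condition_assoc, hret, reassoc_of% hρ]
  simp

/-- Compatible right approximations of a short exact sequence. -/
theorem icp_horseshoe (h : IsInjectiveCotorsionPair.{w} W F) {X Y Z : A} {i : X ⟶ Y} {p : Y ⟶ Z}
    (hs : IsShortExact i p) :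
    ∃ (X' Y' Z' U1 U2 U3 : A) (i' : X' ⟶ Y') (p' : Y' ⟶ Z')
      (a1 : X ⟶ X') (b1 : X' ⟶ U1) (a2 : Y ⟶ Y') (b2 : Y' ⟶ U2) (a3 : Z ⟶ Z') (b3 : Z' ⟶ U3),
      IsShortExact i' p' ∧ IsShortExact a1 b1 ∧ IsShortExact a2 b2 ∧ IsShortExact a3 b3 ∧
      X' ∈ F ∧ Y' ∈ F ∧ Z' ∈ F ∧ U1 ∈ W ∧ U2 ∈ W ∧ U3 ∈ W := by
  have hcok := icp_coker h
  obtain ⟨⟨hc, hl, hr⟩, hW, hI⟩ := h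
  obtain ⟨X', U1, a1, b1, hX', hU1, h1⟩ := hr X
  obtain ⟨q, hq⟩ := ses_pushout hs a1
  obtain ⟨q2, hq2⟩ := ses_pushout h1 i
  obtain ⟨Y', U3, c, d, hY', hU3, hcd⟩ := hr (pushout i a1)
  obtain ⟨U2, b2, m, n, hb2, hmn⟩ := ses_comp hq2 hcd
  have hq' : IsShortExact (pushout.inr i a1) ((pushoutSymmetry i a1).hom ≫ q) := by
    have := ses_mono hs
    have := ses_epi hq
    refine ses_mk_cok _ _ inferInstance inferInstance ?_ ?_
    · simp [ses_zero hq]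
    · intro B k hk
      obtain ⟨l, hl⟩ := ses_desc hq ((pushoutSymmetry i a1).inv ≫ k) (by simp [hk])
      exact ⟨l, by simp [hl]⟩
  obtain ⟨Z', p', a3, b3, hp', h3⟩ := ses_comp hq' hcd
  exact ⟨X', Y', Z', U1, U2, U3, _, p', a1, b1, _, b2, a3, b3, hp', h1, hb2, h3, hX', hY',
    hcok _ _ hp' hX' hY', hU1, (hW.2 _ _ hmn).2.1 hU1 hU3, hU3⟩

theorem icp_key (h : IsInjectiveCotorsionPair.{w} W F)
    {T : Set A} (hTF : T ⊆ F) (hTinj : ∀ X : A, Injective X → X ∈ T) (hT : IsFThick F T)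
    {X Y : A} (s : Y ⟶ X) (r : X ⟶ Y) (e : s ≫ r = 𝟙 Y) (hX : X ∈ WClass W T)
    {Fo Wo : A} {i : Y ⟶ Fo} {p : Fo ⟶ Wo} (hs : IsShortExact i p) (hF : Fo ∈ F)
    (hWo : Wo ∈ W) : Fo ∈ T := by
  obtain ⟨⟨hc, hl, hr⟩, hW, hI⟩ := h
  obtain ⟨To, W1, j, q, hjq, hTo, hW1⟩ := hX
  obtain ⟨f, hf⟩ := cp_extend hc hs hWo (hTF hTo) (s ≫ j)
  obtain ⟨g, hg⟩ := cp_extend hc hjq hW1 hF (r ≫ i)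
  obtain ⟨d, hd⟩ := ses_desc hs (𝟙 Fo - f ≫ g) (by
    rw [Preadditive.comp_sub, reassoc_of% hf, hg, reassoc_of% e]; simp)
  obtain ⟨I, W2, a, b, hIF, hW2, hab⟩ := hr Wo
  have hIW : I ∈ W := (hW.2 _ _ hab).2.1 hWo hW2
  have hIT : I ∈ T := hTinj I ((hI I).1 ⟨hIW, hIF⟩)
  obtain ⟨d', hd'⟩ := cp_extend hc hab hW2 hF d
  have hsum : (To ⊞ I) ∈ T := by
    have hb := ses_biprod To I
    exact (hT.2 _ _ hb (hTF hTo) (cp_ext hc hb (hTF hTo) hIF) hIF).2.1 hTo hIT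
  refine hT.1 (To ⊞ I) Fo (biprod.lift f (p ≫ a)) (biprod.desc g d') ?_ hsum
  rw [biprod.lift_desc, Category.assoc, hd', hd]
  simp

end Pair

theorem WClass_properties [EnoughInjectives A] [HasExt.{w} A] (W F : Set A)
    (h : IsInjectiveCotorsionPair.{w} W F)
    (T : Set A) (hTF : T ⊆ F) (hTinj : ∀ X : A, Injective X → X ∈ T)
    (hT : IsFThick F T) :
    (∀ X : A, X ∈ WClass W T ↔
      ∀ ⦃Fo Wo : A⦄ (i : X ⟶ Fo) (p : Fo ⟶ Wo),
        IsShortExact i p → Fo ∈ F → Wo ∈ W → Fo ∈ T) ∧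
    (IsThickClass (WClass W T) ∧ T ⊆ WClass W T ∧ W ⊆ WClass W T) ∧
    WClass W T ∩ F = T := by
  have key := @icp_key A _ _ _ W F h T hTF hTinj hT
  have h' := h
  obtain ⟨⟨hc, hl, hr⟩, hW, hI⟩ := h'
  obtain ⟨O, h0⟩ : ∃ O : A, IsZero O := HasZeroObject.zero
  have h0W : O ∈ W := ((hI O).2 h0.injective).1
  have P1 : ∀ X : A, X ∈ WClass W T ↔
      ∀ ⦃Fo Wo : A⦄ (i : X ⟶ Fo) (p : Fo ⟶ Wo),
        IsShortExact i p → Fo ∈ F → Wo ∈ W → Fo ∈ T := by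
    intro X
    constructor
    · intro hX Fo Wo i p hs hF hWo
      exact key (𝟙 X) (𝟙 X) (by simp) hX hs hF hWo
    · intro H
      obtain ⟨Fo, Wo, i, p, hF, hWo, hs⟩ := hr X
      exact ⟨Fo, Wo, i, p, hs, H i p hs hF hWo, hWo⟩
  have P2 : ∀ {X Fo Wo : A} {i : X ⟶ Fo} {p : Fo ⟶ Wo},
        IsShortExact i p → Fo ∈ F → Wo ∈ W → (X ∈ WClass W T ↔ Fo ∈ T) := by
    intro X Fo Wo i p hs hF hWo
    exact ⟨fun hX => (P1 X).1 hX i p hs hF hWo, fun hT' => ⟨Fo, Wo, i, p, hs, hT', hWo⟩⟩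
  have hTW : T ⊆ WClass W T := fun X hX => ⟨X, O, 𝟙 X, 0, ses_id h0, hX, h0W⟩
  refine ⟨P1, ⟨⟨?_, ?_⟩, hTW, ?_⟩, ?_⟩
  · intro X Y s r e hX
    obtain ⟨Fo, Wo, i, p, hF, hWo, hs⟩ := hr Y
    exact ⟨Fo, Wo, i, p, hs, key s r e hX hs hF hWo, hWo⟩
  · intro X Y Z i p hs
    obtain ⟨X', Y', Z', U1, U2, U3, i', p', a1, b1, a2, b2, a3, b3, hs', e1, e2, e3, f1, f2, f3,
      w1, w2, w3⟩ := icp_horseshoe h hs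
    rw [P2 e1 f1 w1, P2 e2 f2 w2, P2 e3 f3 w3]
    exact hT.2 _ _ hs' f1 f2 f3
  · intro X hX
    obtain ⟨Fo, Wo, i, p, hF, hWo, hs⟩ := hr X
    have hFW : Fo ∈ W := (hW.2 _ _ hs).2.1 hX hWo
    exact ⟨Fo, Wo, i, p, hs, hTinj _ ((hI _).1 ⟨hFW, hF⟩), hWo⟩
  · ext X
    constructor
    · rintro ⟨hX, hF⟩
      exact (P2 (ses_id h0) hF h0W).1 hX
    · intro hX
      exact ⟨hTW hX, hTF hX⟩
end

section
/- Let A be an abelian category with enough injectives and let (W, F) be an injective cotorsion pair. Then every object of F is Gorenstein injective. -/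
open CategoryTheory CategoryTheory.Limits

universe w v u

variable {A : Type u} [Category.{v} A] [Abelian A]

/-- `M` is Gorenstein injective: `M = Z₀ J` for some exact complex `J` of injectives which
remains exact after applying `Hom(I, -)` for every injective object `I`. -/
def IsGorensteinInjective (M : A) : Prop :=
  ∃ J : ChainComplex A ℤ,
    (∀ n : ℤ, Injective (J.X n)) ∧
    (∀ n : ℤ, (ShortComplex.mk (J.d (n + 1) n) (J.d n (n - 1)) (J.d_comp_d _ _ _)).Exact) ∧
    (∃ (ι : M ⟶ J.X 0) (w : ι ≫ J.d 0 (-1) = 0),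
      Mono ι ∧ (ShortComplex.mk ι (J.d 0 (-1)) w).Exact) ∧
    (∀ (I : A), Injective I → ∀ (n : ℤ) (f : I ⟶ J.X n), f ≫ J.d n (n - 1) = 0 →
      ∃ g : I ⟶ J.X (n + 1), g ≫ J.d (n + 1) n = f)


section Helpers

theorem aux_lift [HasExt.{w} A] {V X Y Z : A} (hV : Ext1Zero.{w} V X) {i : X ⟶ Y} {p : Y ⟶ Z}
    (hs : IsShortExact i p) (f : V ⟶ Z) : ∃ g : V ⟶ Y, g ≫ p = f := by
  obtain ⟨w0, hs⟩ := hs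
  have : Subsingleton (Abelian.Ext V X 1) := hV
  obtain ⟨y, hy⟩ := Abelian.Ext.covariant_sequence_exact₃ V hs (Abelian.Ext.mk₀ f)
    (zero_add 1) (Subsingleton.elim (α := Abelian.Ext V X 1) _ _)
  obtain ⟨g, rfl⟩ := (Abelian.Ext.mk₀_bijective V _).2 y
  refine ⟨g, (Abelian.Ext.mk₀_bijective V _).1 ?_⟩
  rw [← hy, Abelian.Ext.mk₀_comp_mk₀]

theorem aux_ext_zero [HasExt.{w} A] {V C J Q : A} [Injective J] {i : C ⟶ J} {p : J ⟶ Q}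
    (hs : IsShortExact i p) (h : ∀ f : V ⟶ Q, ∃ g : V ⟶ J, g ≫ p = f) : Ext1Zero.{w} V C := by
  obtain ⟨w0, hs⟩ := hs
  refine subsingleton_of_forall_eq 0 fun x => ?_
  obtain ⟨y, rfl⟩ := Abelian.Ext.covariant_sequence_exact₁ V hs x
    (Abelian.Ext.eq_zero_of_injective _) (zero_add 1)
  obtain ⟨f, rfl⟩ := (Abelian.Ext.mk₀_bijective V _).2 y
  obtain ⟨g, rfl⟩ := h f
  have := Abelian.Ext.mk₀_comp_mk₀ g p
  rw [← this, Abelian.Ext.comp_assoc_of_second_deg_zero]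
  have h0 := hs.comp_extClass
  dsimp at h0
  rw [h0, Abelian.Ext.comp_zero]

theorem aux_ext_middle [HasExt.{w} A] {V X Y Z : A} {i : X ⟶ Y} {p : Y ⟶ Z}
    (hs : IsShortExact i p) (hX : Ext1Zero.{w} V X) (hZ : Ext1Zero.{w} V Z) :
    Ext1Zero.{w} V Y := by
  obtain ⟨w0, hs⟩ := hs
  have : Subsingleton (Abelian.Ext V X 1) := hX
  have : Subsingleton (Abelian.Ext V Z 1) := hZ
  refine subsingleton_of_forall_eq 0 fun x => ?_
  obtain ⟨y, rfl⟩ := Abelian.Ext.covariant_sequence_exact₂ V hs x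
    (Subsingleton.elim (α := Abelian.Ext V Z 1) _ _)
  rw [Subsingleton.elim (α := Abelian.Ext V X 1) y 0, Abelian.Ext.zero_comp]

theorem aux_coker {X Y : A} (f : X ⟶ Y) [Mono f] : IsShortExact f (cokernel.π f) :=
  ⟨cokernel.condition f, { exact := ShortComplex.exact_cokernel f }⟩

theorem aux_ker {X Y : A} (f : X ⟶ Y) [Epi f] : IsShortExact (kernel.ι f) f :=
  ⟨kernel.condition f, { exact := ShortComplex.exact_kernel f }⟩

/-- The cosyzygy of an object of `F` is in `F`. -/
theorem aux_next [EnoughInjectives A] [HasExt.{w} A] {W F : Set A}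
    (h : IsInjectiveCotorsionPair.{w} W F) {X I C : A} (hX : X ∈ F) (hI : Injective I)
    {i : X ⟶ I} {p : I ⟶ C} (hs : IsShortExact i p) : C ∈ F := by
  obtain ⟨⟨⟨-, h2⟩, hc1, -⟩, ⟨-, ht⟩, -⟩ := h
  rw [h2]
  intro V hV
  let j := Injective.ι C
  let π := cokernel.π j
  refine aux_ext_zero (aux_coker j) fun g => ?_
  obtain ⟨_, W', _, r, -, hW', ⟨_, hr⟩⟩ := hc1 (pullback π g)
  have : Epi r := hr.epi_g
  let q : W' ⟶ V := r ≫ pullback.snd π g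
  let l : W' ⟶ Injective.under C := r ≫ pullback.fst π g
  have hl : l ≫ π = q ≫ g := by simp [l, q, pullback.condition]
  have : Epi q := epi_comp _ _
  have hK : kernel q ∈ W := (ht _ _ (aux_ker q)).2.2 hW' hV
  obtain ⟨_, hcok⟩ := aux_coker j
  obtain ⟨_, hker⟩ := aux_ker q
  have : Mono j := inferInstance
  have hz : (kernel.ι q ≫ l) ≫ π = 0 := by
    rw [Category.assoc, hl, kernel.condition_assoc, zero_comp]
  let f : kernel q ⟶ C := hcok.exact.lift (kernel.ι q ≫ l) hz
  have hf : f ≫ j = kernel.ι q ≫ l := hcok.exact.lift_f _ hz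
  obtain ⟨f', hf'⟩ := aux_lift ((h2 X).1 hX _ hK) hs f
  let t : W' ⟶ I := Injective.factorThru f' (kernel.ι q)
  have ht : kernel.ι q ≫ t = f' := Injective.comp_factorThru _ _
  have hd : kernel.ι q ≫ (l - t ≫ p ≫ j) = 0 := by
    rw [Preadditive.comp_sub, reassoc_of% ht, reassoc_of% hf', hf, sub_self]
  refine ⟨hker.exact.desc _ hd, ?_⟩
  have hgd : q ≫ hker.exact.desc _ hd = l - t ≫ p ≫ j := hker.exact.g_desc _ hd
  rw [← cancel_epi q, reassoc_of% hgd, Preadditive.sub_comp, hl]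
  simp [π]

/-- `a` is the kernel of an epimorphism from an injective onto `b`. -/
def AuxRel (a b : A) : Prop :=
  ∃ (J : A) (i : a ⟶ J) (p : J ⟶ b), Injective J ∧ IsShortExact i p

theorem aux_seq (T : Type u) (R : T → T → Prop) (h1 : ∀ t, ∃ s, R s t) (h2 : ∀ t, ∃ s, R t s)
    (x : T) : ∃ Z : ℤ → T, Z 1 = x ∧ ∀ n, R (Z (n + 1)) (Z n) := by
  choose pr hpr using h1
  choose nx hnx using h2
  let Z : ℤ → T := fun n => match n with
    | Int.ofNat k => pr^[k] x
    | Int.negSucc k => nx^[k + 1] x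
  have key : ∀ n, R (Z (n + 1)) (Z n) := by
    intro n
    match n with
    | Int.ofNat k =>
      change R (pr^[k + 1] x) (pr^[k] x)
      rw [Function.iterate_succ_apply']
      exact hpr _
    | Int.negSucc 0 => exact hnx x
    | Int.negSucc (k + 1) =>
      change R (nx^[k + 1] x) (nx^[k + 1 + 1] x)
      rw [Function.iterate_succ_apply' _ (k + 1)]
      exact hnx _
  refine ⟨fun n => Z (n - 1), rfl, fun n => ?_⟩
  have := key (n - 1)
  rwa [show n - 1 + 1 = n + 1 - 1 by ring] at this

theorem aux_exact {P Z1 Y Z2 Q : A} (p1 : P ⟶ Z1) (i1 : Z1 ⟶ Y) (p2 : Y ⟶ Z2) (i2 : Z2 ⟶ Q)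
    [Epi p1] [Mono i2] (hs : IsShortExact i1 p2) (w0 : (p1 ≫ i1) ≫ p2 ≫ i2 = 0) :
    (ShortComplex.mk _ _ w0).Exact := by
  obtain ⟨w1, hs⟩ := hs
  let S : ShortComplex A := ShortComplex.mk (p1 ≫ i1) p2 (by simp [w1])
  let φ : S ⟶ ShortComplex.mk i1 p2 w1 := { τ₁ := p1, τ₂ := 𝟙 _, τ₃ := 𝟙 _ }
  let ψ : S ⟶ ShortComplex.mk _ _ w0 := { τ₁ := 𝟙 _, τ₂ := 𝟙 _, τ₃ := i2 }
  have : Epi φ.τ₁ := ‹Epi p1›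
  have : IsIso φ.τ₂ := inferInstanceAs (IsIso (𝟙 Y))
  have : Mono φ.τ₃ := inferInstanceAs (Mono (𝟙 Z2))
  have : Epi ψ.τ₁ := inferInstanceAs (Epi (𝟙 P))
  have : IsIso ψ.τ₂ := inferInstanceAs (IsIso (𝟙 Y))
  have : Mono ψ.τ₃ := ‹Mono i2›
  rw [← ShortComplex.exact_iff_of_epi_of_isIso_of_mono ψ,
    ShortComplex.exact_iff_of_epi_of_isIso_of_mono φ]
  exact hs.exact

end Helpers

theorem fibrant_objects_are_gorenstein_injective [EnoughInjectives A] [HasExt.{w} A]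
    (W F : Set A) (h : IsInjectiveCotorsionPair.{w} W F) :
    ∀ X ∈ F, IsGorensteinInjective X := by
  intro X hX
  have h' := h
  obtain ⟨⟨⟨h1, h2⟩, hc1, hc2⟩, -, hWF⟩ := h
  have hpr : ∀ t : {Y : A // Y ∈ F}, ∃ s : {Y : A // Y ∈ F}, AuxRel s.1 t.1 := by
    rintro ⟨Y, hY⟩
    obtain ⟨a, J, i, p, ha, hJ, hs⟩ := hc1 Y
    refine ⟨⟨a, ha⟩, J, i, p, (hWF J).1 ⟨hJ, ?_⟩, hs⟩
    rw [h2]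
    exact fun V hV => aux_ext_middle hs ((h2 _).1 ha V hV) ((h2 _).1 hY V hV)
  have hnx : ∀ t : {Y : A // Y ∈ F}, ∃ s : {Y : A // Y ∈ F}, AuxRel t.1 s.1 := by
    rintro ⟨Y, hY⟩
    have hs := aux_coker (Injective.ι Y)
    exact ⟨⟨_, aux_next h' hY inferInstance hs⟩, _, _, _, inferInstance, hs⟩
  obtain ⟨Z, hZ1, hZ⟩ := aux_seq {Y : A // Y ∈ F} (fun a b => AuxRel a.1 b.1) hpr hnx ⟨X, hX⟩
  choose K i p hK hs using hZ
  have hmono : ∀ n, Mono (i n) := fun n => (hs n).2.mono_f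
  have hepi : ∀ n, Epi (p n) := fun n => (hs n).2.epi_g
  have hip : ∀ n, i n ≫ p n = 0 := fun n => (hs n).1
  let J : ChainComplex A ℤ := ChainComplex.of K (fun n => p (n + 1) ≫ i n) (fun n => by
    rw [Category.assoc, reassoc_of% (hip (n + 1)), zero_comp, comp_zero])
  have hJd : ∀ n, J.d (n + 1) n = p (n + 1) ≫ i n := fun n => ChainComplex.of_d K (fun n => p (n + 1) ≫ i n) n
  have hX0 : X = (Z (0 + 1)).1 := by rw [zero_add, hZ1]
  clear hZ1
  subst hX0
  refine ⟨J, hK, ?_, ?_, ?_⟩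
  · have key : ∀ a b c : ℤ, a = b + 1 → b = c + 1 → ∀ w0,
        (ShortComplex.mk (J.d a b) (J.d b c) w0).Exact := by
      rintro a b c rfl rfl w0
      simp only [hJd]
      exact aux_exact _ _ _ _ (hs (c + 1)) _
    exact fun n => key _ _ _ rfl (by ring) _
  · have key : ∀ a b : ℤ, a = b + 1 → ∃ w0 : (show (Z (a + 1)).1 ⟶ J.X a from i a) ≫ J.d a b = 0,
        (ShortComplex.mk _ _ w0).Exact := by
      rintro a b rfl
      simp only [hJd]
      have h0 : (𝟙 _ ≫ i (b + 1)) ≫ p (b + 1) ≫ i b = 0 := by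
        rw [Category.id_comp, reassoc_of% (hip (b + 1)), zero_comp]
      have := aux_exact (𝟙 _) (i (b + 1)) (p (b + 1)) (i b) (hs (b + 1)) h0
      simp only [Category.id_comp] at this h0
      exact ⟨h0, this⟩
    obtain ⟨w0, hw⟩ := key 0 (-1) (by norm_num)
    exact ⟨i 0, w0, hmono 0, hw⟩
  · intro I hI n f
    have key : ∀ b : ℤ, n = b + 1 → f ≫ J.d n b = 0 →
        ∃ g : I ⟶ J.X (n + 1), g ≫ J.d (n + 1) n = f := by
      rintro b rfl hf
      rw [hJd] at hf
      have hf1 : (show I ⟶ K (b + 1) from f) ≫ p (b + 1) = 0 := by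
        rw [← cancel_mono (i b), zero_comp, Category.assoc]
        exact hf
      obtain ⟨w1, hs1⟩ := hs (b + 1)
      have : Mono (i (b + 1)) := hmono _
      let f1 : I ⟶ (Z (b + 1 + 1)).1 := hs1.exact.lift f hf1
      have hf2 : f1 ≫ i (b + 1) = f := hs1.exact.lift_f _ hf1
      obtain ⟨g, hg⟩ := aux_lift ((h2 _).1 (Z (b + 1 + 1 + 1)).2 I ((hWF I).2 hI).1)
        (hs (b + 1 + 1)) f1
      refine ⟨g, ?_⟩
      rw [hJd]
      exact (Category.assoc _ _ _).symm.trans ((congrArg (· ≫ i (b + 1)) hg).trans hf2)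
    exact key _ (by ring)
end
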